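/- arXiv:2204.13654 — 8 statements merged into one kernel-verified Lean document; each statement's English description precedes it below -/
import Mathlib

section
/- Let X be a pseudo-extended-metric space and Y a pseudo-extended-metric space whose distance is an ultrametric (edist y₁ y₃ ≤ max (edist y₁ y₂) (edist y₂ y₃) for all y₁, y₂, y₃). Then for all non-expansive f, g : X → Y, Ξ(f,g) = Φ(f,g), i.e. the exponential distance Ξ coincides with the sup-distance. -/
open scoped ENNReal

noncomputable def Xi {X Y : Type*} [PseudoEMetricSpace X] [PseudoEMetricSpace Y]
    (f g : X → Y) : ℝ≥0∞ :=
  sInf {δ : ℝ≥0∞ | ∀ x y, edist (f x) (g y) ≤ max δ (edist x y)}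

noncomputable def Phi {X Y : Type*} [PseudoEMetricSpace X] [PseudoEMetricSpace Y]
    (f g : X → Y) : ℝ≥0∞ :=
  ⨆ x, edist (f x) (g x)

def Nonexpansive {X Y : Type*} [PseudoEMetricSpace X] [PseudoEMetricSpace Y]
    (f : X → Y) : Prop :=
  ∀ x y, edist (f x) (f y) ≤ edist x y

theorem Xi_eq_Phi_of_ultrametric {X Y : Type*} [PseudoEMetricSpace X] [PseudoEMetricSpace Y]
    (hY : ∀ y₁ y₂ y₃ : Y, edist y₁ y₃ ≤ max (edist y₁ y₂) (edist y₂ y₃)) :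
    ∀ f g : X → Y, Nonexpansive f → Nonexpansive g → Xi f g = Phi f g := by
  intro f g _ hg
  refine le_antisymm (sInf_le fun x y => ?_) (le_sInf fun δ hδ => iSup_le fun x => ?_)
  · exact (hY (f x) (g x) (g y)).trans
      (max_le_max (le_iSup (fun x => edist (f x) (g x)) x) (hg x y))
  · simpa using hδ x x
end

section
/- Let X be a pseudo-metric space satisfying condition (*): for all x₀, x₂ ∈ X and all reals α, β ≥ 0 with α + β = dist x₀ x₂, and for every ε > 0, there exists x₁ ∈ X with dist x₀ x₁ < α + ε and dist x₁ x₂ < β + ε. Then for every pseudo-extended-metric space Y and all non-expansive f, g, h : X → Y, the distance Ξ satisfies the triangle inequality Ξ(f,g) ≤ Ξ(f,h) + Ξ(h,g). -/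
open scoped ENNReal

theorem edist_le_max_add_of_star {X Y : Type*} [PseudoMetricSpace X] [PseudoEMetricSpace Y]
    (hstar : ∀ (x₀ x₂ : X) (α β : ℝ), 0 ≤ α → 0 ≤ β → α + β = dist x₀ x₂ →
      ∀ ε : ℝ, 0 < ε → ∃ x₁ : X, dist x₀ x₁ < α + ε ∧ dist x₁ x₂ < β + ε)
    {f g h : X → Y} {a b : ℝ≥0∞}
    (ha : ∀ x y, edist (f x) (h y) ≤ max a (edist x y))
    (hb : ∀ x y, edist (h x) (g y) ≤ max b (edist x y)) (x y : X) :
    edist (f x) (g y) ≤ max (a + b) (edist x y) := by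
  induction a with
  | top => simp
  | coe a =>
  induction b with
  | top => simp
  | coe b =>
  refine ENNReal.le_of_forall_pos_le_add fun ε hε _ => ?_
  have hε' : (0 : ℝ) < ε := hε
  obtain ⟨z, hxz, hzy⟩ := hstar x y (min (a : ℝ) (dist x y)) (dist x y - min (a : ℝ) (dist x y))
    (by positivity) (sub_nonneg.2 (min_le_right _ _)) (add_sub_cancel _ _) (ε / 2) (by positivity)
  have hsum : max (a : ℝ) (dist x z) + max (b : ℝ) (dist z y)
      ≤ max ((a : ℝ) + b) (dist x y) + ε := by
    have hb₀ : (0 : ℝ) ≤ b := b.2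
    rw [max_add, add_max, add_max]
    have hab := le_max_left ((a : ℝ) + b) (dist x y)
    have hxy := le_max_right ((a : ℝ) + b) (dist x y)
    rcases min_cases (a : ℝ) (dist x y) with ⟨hm, hle⟩ | ⟨hm, hlt⟩ <;> rw [hm] at hxz hzy <;>
      refine max_le (max_le ?_ ?_) (max_le ?_ ?_) <;> linarith
  calc edist (f x) (g y) ≤ edist (f x) (h z) + edist (h z) (g y) := edist_triangle _ _ _
    _ ≤ max (a : ℝ≥0∞) (edist x z) + max (b : ℝ≥0∞) (edist z y) :=
      add_le_add (ha x z) (hb z y)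
    _ ≤ max ((a : ℝ≥0∞) + b) (edist x y) + ε := by
      simp only [edist_nndist]
      exact_mod_cast hsum

theorem Xi_triangle_of_star {X : Type*} [PseudoMetricSpace X]
    (hstar : ∀ (x₀ x₂ : X) (α β : ℝ), 0 ≤ α → 0 ≤ β → α + β = dist x₀ x₂ →
      ∀ ε : ℝ, 0 < ε → ∃ x₁ : X, dist x₀ x₁ < α + ε ∧ dist x₁ x₂ < β + ε)
    {Y : Type*} [PseudoEMetricSpace Y]
    (f g h : X → Y) (hf : Nonexpansive f) (hg : Nonexpansive g) (hh : Nonexpansive h) :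
    Xi f g ≤ Xi f h + Xi h g := by
  unfold Xi
  rw [ENNReal.sInf_add]
  refine le_iInf₂ fun a ha => ?_
  rw [ENNReal.add_sInf]
  exact le_iInf₂ fun b hb => sInf_le (edist_le_max_add_of_star hstar ha hb)
end

section
/- Let K > 0 be a real number and let f, g : ℝ → ℝ be given by f x = x and g x = x + K. Then Φ(f,g) = ENNReal.ofReal K, while Ξ(f,g) = ∞. -/
open scoped ENNReal

theorem Phi_vs_Xi_translation (K : ℝ) (hK : 0 < K) :
    Phi (fun x : ℝ => x) (fun x : ℝ => x + K) = ENNReal.ofReal K ∧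
    Xi (fun x : ℝ => x) (fun x : ℝ => x + K) = ∞ := by
  constructor
  · simp [Phi, edist_dist, abs_of_pos hK]
  · refine sInf_eq_top.2 fun δ hδ => ?_
    by_contra hne
    have h := hδ 0 δ.toReal
    have h0 : (0 : ℝ) ≤ δ.toReal := ENNReal.toReal_nonneg
    have hsum : 0 ≤ δ.toReal + K := by positivity
    simp only [edist_dist, Real.dist_eq, zero_sub, abs_neg, abs_of_nonneg h0,
      abs_of_nonneg hsum, ENNReal.ofReal_toReal hne, max_self] at h
    have := (ENNReal.ofReal_le_iff_le_toReal hne).1 h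
    linarith
end

section
/- Let b ≥ 0 and ε > 0 be real numbers, and let f, g : Set.Icc (0:ℝ) b → ℝ be given by f x = x and g x = x + ε (both are non-expansive). Then Φ(f,g) = ENNReal.ofReal ε, while Ξ(f,g) = ENNReal.ofReal (b + ε). In particular the quantitative ξ-rule fails: the pointwise distance of f and g is ε but their Ξ-distance is b + ε. -/
open scoped ENNReal

theorem xi_rule_failure_on_interval (b ε : ℝ) (hb : 0 ≤ b) (hε : 0 < ε) :
    Phi (fun x : Set.Icc (0:ℝ) b => (x : ℝ)) (fun x : Set.Icc (0:ℝ) b => (x : ℝ) + ε)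
      = ENNReal.ofReal ε ∧
    Xi (fun x : Set.Icc (0:ℝ) b => (x : ℝ)) (fun x : Set.Icc (0:ℝ) b => (x : ℝ) + ε)
      = ENNReal.ofReal (b + ε) := by
  have hdist (x y : ℝ) : edist x (y + ε) = ENNReal.ofReal |x - (y + ε)| := by
    rw [edist_dist, Real.dist_eq]
  have h0 : (0 : ℝ) ∈ Set.Icc 0 b := ⟨le_rfl, hb⟩
  constructor
  · have : Nonempty (Set.Icc (0 : ℝ) b) := ⟨⟨0, h0⟩⟩
    simp [Phi, hdist, abs_of_pos hε]
  · refine le_antisymm (sInf_le fun x y => le_max_of_le_left ?_) (le_sInf fun δ hδ => ?_)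
    · rw [hdist]
      refine ENNReal.ofReal_le_ofReal (abs_le.2 ⟨?_, ?_⟩) <;>
        linarith [x.2.1, x.2.2, y.2.1, y.2.2]
    · have h := hδ ⟨0, h0⟩ ⟨b, hb, le_rfl⟩
      rw [hdist, Subtype.edist_eq, edist_dist, Real.dist_eq, zero_sub, zero_sub, abs_neg,
        abs_neg, abs_of_nonneg hb, abs_of_pos (by positivity : 0 < b + ε)] at h
      refine (le_max_iff.1 h).resolve_right (not_le.2 ?_)
      exact (ENNReal.ofReal_lt_ofReal_iff (by positivity)).2 (by linarith)
end

section
/- Let A be a quantitative combinatory algebra, i.e. a pseudo-metric space with a binary operation · satisfying dist (a·c) (b·e) ≤ max (dist a b) (dist c e) for all a, b, c, e, and with elements k, s ∈ A such that (k·a)·b = a and ((s·a)·b)·c = (a·c)·(b·c) for all a, b, c. Then A is bounded by the distance between the interpretations of K and K(SKK): for all a, b ∈ A, dist a b ≤ dist k (k·((s·k)·k)). -/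
theorem quantitative_combinatory_algebra_bounded {A : Type*} [PseudoMetricSpace A]
    (op : A → A → A)
    (hne : ∀ a b c e : A, dist (op a c) (op b e) ≤ max (dist a b) (dist c e))
    (k s : A)
    (hk : ∀ a b : A, op (op k a) b = a)
    (hs : ∀ a b c : A, op (op (op s a) b) c = op (op a c) (op b c)) :
    ∀ a b : A, dist a b ≤ dist k (op k (op (op s k) k)) := by
  intro a b
  have happ : ∀ x y c : A, dist (op x c) (op y c) ≤ dist x y := fun x y c => by
    simpa using hne x y c c
  calc dist a b = dist (op (op k a) b) (op (op (op k (op (op s k) k)) a) b) := by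
        rw [hk, hk, hs, hk]
    _ ≤ dist (op k a) (op (op k (op (op s k) k)) a) := happ _ _ _
    _ ≤ dist k (op k (op (op s k) k)) := happ _ _ _
end

section
/- Let A be a quantitative combinatory algebra with combinators k, s, and let i := (s·k)·k. If a, b ∈ A are separated by some u ∈ A in the sense that u·a = k and u·b = k·i, then dist a b = dist k (k·i). That is, all pairs of points that some element of the algebra maps onto the interpretations of K and K(SKK) respectively are at exactly that distance from each other. -/
theorem separated_points_at_max_distance {A : Type*} [PseudoMetricSpace A]
    (op : A → A → A)
    (hne : ∀ a b c e : A, dist (op a c) (op b e) ≤ max (dist a b) (dist c e))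
    (k s : A)
    (hk : ∀ a b : A, op (op k a) b = a)
    (hs : ∀ a b c : A, op (op (op s a) b) c = op (op a c) (op b c)) :
    ∀ i : A, i = op (op s k) k →
      ∀ a b u : A, op u a = k → op u b = op k i → dist a b = dist k (op k i) := by
  rintro i rfl a b u ha hb
  apply le_antisymm
  · calc dist a b = dist (op (op k a) b) (op (op (op k (op (op s k) k)) a) b) := by
          simp only [hk, hs]
      _ ≤ dist (op k a) (op (op k (op (op s k) k)) a) := by
          simpa only [dist_self, max_eq_left dist_nonneg] using
            hne (op k a) (op (op k (op (op s k) k)) a) b b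
      _ ≤ dist k (op k (op (op s k) k)) := by
          simpa only [dist_self, max_eq_left dist_nonneg] using hne k (op k (op (op s k) k)) a a
  · calc dist k (op k (op (op s k) k)) = dist (op u a) (op u b) := by rw [ha, hb]
      _ ≤ dist a b := by simpa only [dist_self, max_eq_right dist_nonneg] using hne u u a b
end

section
/- There are no non-trivial compact quantitative combinatory algebras: if A is a quantitative combinatory algebra whose underlying pseudo-metric space is compact (CompactSpace A), then A is metrically trivial, i.e. dist a b = 0 for all a, b ∈ A. -/
/-- A self-map that is expanding and keeps its range at distance at least `r` from `x` generates
an `r`-separated orbit of `x`. -/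
theorem le_dist_iterate_of_lt {A : Type*} [PseudoMetricSpace A] {f : A → A} {x : A} {r : ℝ}
    (hexp : ∀ y z, dist y z ≤ dist (f y) (f z)) (hx : ∀ y, r ≤ dist x (f y)) {m n : ℕ}
    (hmn : m < n) : r ≤ dist (f^[m] x) (f^[n] x) := by
  induction m generalizing n with
  | zero =>
    obtain ⟨n, rfl⟩ := Nat.exists_eq_add_of_lt hmn
    simpa only [Function.iterate_succ_apply', Function.iterate_zero_apply] using hx _
  | succ m ih =>
    cases n with
    | zero => omega
    | succ n =>
      simp only [Function.iterate_succ_apply']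
      exact (ih (by omega)).trans (hexp _ _)

theorem exists_lt_dist_lt_of_compactSpace {A : Type*} [PseudoMetricSpace A] [CompactSpace A]
    (u : ℕ → A) {r : ℝ} (hr : 0 < r) : ∃ m n, m < n ∧ dist (u m) (u n) < r := by
  obtain ⟨a, φ, hφ, hlim⟩ := CompactSpace.tendsto_subseq u
  obtain ⟨N, hN⟩ := Metric.cauchySeq_iff.1 hlim.cauchySeq r hr
  exact ⟨φ N, φ (N + 1), hφ N.lt_succ_self, hN N le_rfl (N + 1) N.le_succ⟩

theorem exists_pairing_of_combinatory_algebra {A : Type*} (op : A → A → A) (k s : A)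
    (hk : ∀ a b : A, op (op k a) b = a)
    (hs : ∀ a b c : A, op (op (op s a) b) c = op (op a c) (op b c)) :
    ∃ (P : A → A → A) (p q : A), ∀ x y, op (P x y) p = x ∧ op (P x y) q = y := by
  let i := op (op s k) k
  have hi : ∀ x, op i x = x := fun x => by simp only [i, hs, hk]
  refine ⟨fun x y => op (op s (op (op s i) (op k x))) (op k y), k, op k i, fun x y => ?_⟩
  simp only [hs, hk, hi, and_self]

theorem no_nontrivial_compact_quantitative_combinatory_algebra {A : Type*}
    [PseudoMetricSpace A] [CompactSpace A]
    (op : A → A → A)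
    (hne : ∀ a b c e : A, dist (op a c) (op b e) ≤ max (dist a b) (dist c e))
    (k s : A)
    (hk : ∀ a b : A, op (op k a) b = a)
    (hs : ∀ a b c : A, op (op (op s a) b) c = op (op a c) (op b c)) :
    ∀ a b : A, dist a b = 0 := by
  intro a b
  obtain ⟨P, p, q, hP⟩ := exists_pairing_of_combinatory_algebra op k s hk hs
  have happ : ∀ x y z : A, dist (op x z) (op y z) ≤ dist x y := fun x y z => by
    simpa using hne x y z z
  by_contra h
  obtain ⟨m, n, hmn, hlt⟩ := exists_lt_dist_lt_of_compactSpace (fun n => (P a)^[n] (P b b))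
    (dist_nonneg.lt_of_ne' h)
  refine hlt.not_ge (le_dist_iterate_of_lt (fun y z => ?_) (fun y => ?_) hmn)
  · simpa only [(hP _ _).2] using happ (P a y) (P a z) q
  · simpa only [(hP _ _).1, dist_comm b a] using happ (P b b) (P a y) p
end

section
/- Let X and Z be pseudo-extended-metric spaces and Y a pseudo-extended-metric space whose distance is an ultrametric. A function h : Z × X → Y is non-expansive for the max product distance, i.e. edist (h (z,x)) (h (z',x')) ≤ max (edist z z') (edist x x') for all z, z', x, x', if and only if (i) for every z ∈ Z the map h(z,·) : X → Y is non-expansive, and (ii) for all z, z' ∈ Z, Φ(h(z,·), h(z',·)) ≤ edist z z'. This is the currying adjunction making the category of ultrametric spaces and non-expansive maps cartesian closed. -/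
open scoped ENNReal

theorem currying_adjunction_ultrametric {X Y Z : Type*}
    [PseudoEMetricSpace X] [PseudoEMetricSpace Y] [PseudoEMetricSpace Z]
    (hY : ∀ y₁ y₂ y₃ : Y, edist y₁ y₃ ≤ max (edist y₁ y₂) (edist y₂ y₃))
    (h : Z × X → Y) :
    (∀ (z z' : Z) (x x' : X),
        edist (h (z, x)) (h (z', x')) ≤ max (edist z z') (edist x x')) ↔
      ((∀ z : Z, Nonexpansive (fun x => h (z, x))) ∧
        ∀ z z' : Z, Phi (fun x => h (z, x)) (fun x => h (z', x)) ≤ edist z z') := by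
  constructor
  · intro H
    refine ⟨fun z x x' => ?_, fun z z' => iSup_le fun x => ?_⟩
    · simpa using H z z x x'
    · simpa using H z z' x x
  · rintro ⟨hX, hZ⟩ z z' x x'
    calc edist (h (z, x)) (h (z', x'))
        ≤ max (edist (h (z, x)) (h (z', x))) (edist (h (z', x)) (h (z', x'))) := hY _ _ _
      _ ≤ max (edist z z') (edist x x') :=
        max_le_max ((le_iSup (fun x => edist (h (z, x)) (h (z', x))) x).trans (hZ z z'))
          (hX z' x x')
end
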